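/- (Isolated grains retained.) Fix λ > 0 and a Borel probability measure F on [0,∞) with ∫ r^d F(dr) < ∞ that follows a power law with tail exponent α > d, so F̄(r) = ℓ(r)·r^{−α} with ℓ slowly varying. Define h(r) = exp(−λ·|B_1(0)|·∫ (r+s)^d F(ds)); h₂(u, r₁, r₂) = 0 if u ≤ r₁+r₂ and h₂(u, r₁, r₂) = h(r₁)·h(r₂)·exp(λ ∫ |B_{r₁+s}(0) ∩ B_{r₂+s}(u·e₁)| F(ds)) if u > r₁+r₂; q(u,r₁,r₂) = h₂(u,r₁,r₂) − h(r₁)h(r₂); λ_th = λ ∫ h(r) F(dr); F̄_th(r) = (λ/λ_th) ∫_{(r,∞)} h(s) F(ds); p_th = λ ∫ |B_r(0)| h(r) F(dr); k_th(z) = λ ∫ |B_r(0) ∩ B_r(z)| h(r) F(dr) + λ² ∭ |B_{r₁}(0) ∩ B_{r₂}(x)|·q(|x−z|, r₁, r₂) dx F(dr₁) F(dr₂); and ξ_th(z) = (λ/λ_th)² ∬ q(|z|, r₁, r₂) F(dr₁) F(dr₂). Then: (i) F̄_th(r) ≤ (λ/λ_th)·exp(−λ·|B_1(0)|·r^d)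 for all r ≥ 0; (ii) k_th(z)/(λ·c_{α,d}·p_th²·ℓ(|z|)·|z|^{−(α−d)}) → 1 as |z| → ∞; and (iii) ξ_th(z)/(λ·c_{α,d}·ℓ(|z|)·|z|^{−(α−d)}) → 1 as |z| → ∞, where c_{α,d} = ∫₀^∞ |B_r(0) ∩ B_r(e₁)|·α·r^{−α−1} dr. -/

import Mathlib

open MeasureTheory Filter Set Metric ProbabilityTheory

noncomputable section

/-- A measurable positive function is slowly varying at infinity if `ℓ(a t)/ℓ(t) → 1`
as `t → ∞` for every `a > 0`. -/
def SlowlyVarying (ℓ : ℝ → ℝ) : Prop :=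
  Measurable ℓ ∧ (∀ x > 0, 0 < ℓ x) ∧
    ∀ a > 0, Tendsto (fun t => ℓ (a * t) / ℓ t) atTop (nhds 1)

/-- Tail function `F̄(x) = F((x,∞))` of a measure on `ℝ`. -/
def tailF (F : Measure ℝ) (x : ℝ) : ℝ := (F (Ioi x)).toReal

/-- `d`-dimensional Euclidean space. -/
abbrev Euc (d : ℕ) := EuclideanSpace ℝ (Fin d)

/-- The first standard basis vector of `ℝ^d`. -/
def e1 (d : ℕ) : Euc d := if h : 0 < d then EuclideanSpace.single (⟨0, h⟩ : Fin d) 1 else 0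

/-- Volume of the closed ball of radius `r` in `ℝ^d`. -/
def ballVol (d : ℕ) (r : ℝ) : ℝ := (volume (closedBall (0 : Euc d) r)).toReal

/-- Volume of the intersection of closed balls `B_r(x)` and `B_s(y)` in `ℝ^d`. -/
def interVol (d : ℕ) (x : Euc d) (r : ℝ) (y : Euc d) (s : ℝ) : ℝ :=
  (volume (closedBall x r ∩ closedBall y s)).toReal

/-- The constant `c_{α,d} = ∫₀^∞ |B_r(0) ∩ B_r(e₁)| α r^{-α-1} dr`. -/
def cconst (d : ℕ) (α : ℝ) : ℝ :=
  ∫ r in Ioi (0 : ℝ), interVol d 0 r (e1 d) r * (α * r ^ (-α - 1))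

/-- Retention probability for the isolated-retained (Matérn type I) thinning. -/
def hI (d : ℕ) (lam : ℝ) (F : Measure ℝ) (r : ℝ) : ℝ :=
  Real.exp (-(lam * ballVol d 1 * ∫ s, (r + s) ^ d ∂F))

/-- Pair retention probability for the isolated-retained thinning. -/
def h2I (d : ℕ) (lam : ℝ) (F : Measure ℝ) (u r₁ r₂ : ℝ) : ℝ :=
  if u ≤ r₁ + r₂ then 0
  else hI d lam F r₁ * hI d lam F r₂ *
    Real.exp (lam * ∫ s, interVol d 0 (r₁ + s) (u • e1 d) (r₂ + s) ∂F)

/-- Retention covariance for the isolated-retained thinning. -/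
def qI (d : ℕ) (lam : ℝ) (F : Measure ℝ) (u r₁ r₂ : ℝ) : ℝ :=
  h2I d lam F u r₁ r₂ - hI d lam F r₁ * hI d lam F r₂

/-- Thinned germ density `λ_th = λ ∫ h(r) F(dr)`. -/
def lamth (lam : ℝ) (F : Measure ℝ) (h : ℝ → ℝ) : ℝ := lam * ∫ r, h r ∂F

/-- Tail distribution `F̄_th(r) = (λ/λ_th) ∫_{(r,∞)} h(s) F(ds)` of the radius of a
typical grain in the thinned model. -/
def tailth (lam : ℝ) (F : Measure ℝ) (h : ℝ → ℝ) (r : ℝ) : ℝ :=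
  (lam / lamth lam F h) * ∫ s in Ioi r, h s ∂F

/-- Volume fraction `p_th = λ ∫ |B_r(0)| h(r) F(dr)` of the thinned grain cover. -/
def pth (d : ℕ) (lam : ℝ) (F : Measure ℝ) (h : ℝ → ℝ) : ℝ :=
  lam * ∫ r, ballVol d r * h r ∂F

/-- Covariance function of the thinned grain cover. -/
def kth (d : ℕ) (lam : ℝ) (F : Measure ℝ) (h : ℝ → ℝ) (q : ℝ → ℝ → ℝ → ℝ)
    (z : Euc d) : ℝ :=
  lam * ∫ r, interVol d 0 r z r * h r ∂F +
    lam ^ 2 * ∫ r₁, (∫ r₂, (∫ x, interVol d 0 r₁ x r₂ * q (‖x - z‖) r₁ r₂) ∂F) ∂F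

/-- Two-point correlation function of the thinned grain centers. -/
def xith (d : ℕ) (lam : ℝ) (F : Measure ℝ) (h : ℝ → ℝ) (q : ℝ → ℝ → ℝ → ℝ)
    (z : Euc d) : ℝ :=
  (lam / lamth lam F h) ^ 2 * ∫ r₁, (∫ r₂, q ‖z‖ r₁ r₂ ∂F) ∂F


section RegVar

lemma aux_potter_iter {T : ℝ → ℝ} {ρ w0 : ℝ} (hρ : 0 ≤ ρ) (hw0 : 0 ≤ w0)
    (h : ∀ w ≥ w0, T (2 * w) ≤ ρ * T w) (n : ℕ) :
    ∀ w ≥ w0, T (2 ^ n * w) ≤ ρ ^ n * T w := by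
  induction n with
  | zero => intro w _; simp
  | succ k ih =>
    intro w hw
    have h1 : T (2 ^ k * (2 * w)) ≤ ρ ^ k * T (2 * w) := ih (2 * w) (by linarith)
    have h2 := mul_le_mul_of_nonneg_left (h w hw) (pow_nonneg hρ k)
    have e : (2:ℝ) ^ (k+1) * w = 2 ^ k * (2 * w) := by ring
    rw [e]
    calc _ ≤ _ := h1
      _ ≤ _ := h2
      _ = _ := by ring

lemma aux_potter_iter_lower {T : ℝ → ℝ} {ρ w0 : ℝ} (hρ : 0 ≤ ρ) (hw0 : 0 ≤ w0)
    (h : ∀ w ≥ w0, ρ * T w ≤ T (2 * w)) (n : ℕ) :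
    ∀ w ≥ w0, ρ ^ n * T w ≤ T (2 ^ n * w) := by
  intro w hw
  have := aux_potter_iter (T := fun x => - T x) hρ hw0 (fun w hw => by
    have := h w hw
    linarith) n w hw
  linarith

lemma aux_dyadic {t : ℝ} (ht : 1 ≤ t) : ∃ n : ℕ, (2:ℝ) ^ n ≤ t ∧ t < 2 ^ (n+1) :=
  exists_nat_pow_near ht (by norm_num)

lemma aux_rpow_pow {β : ℝ} (n : ℕ) : ((2:ℝ) ^ (-β)) ^ n = ((2:ℝ) ^ n) ^ (-β) := by
  rw [← Real.rpow_natCast, ← Real.rpow_mul (by norm_num), mul_comm, Real.rpow_mul (by norm_num),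
    Real.rpow_natCast]

lemma aux_potter {T : ℝ → ℝ} {α β : ℝ} (hanti : Antitone T) (hpos : ∀ x, 0 < T x)
    (hr : ∀ a > 0, Tendsto (fun t => T (a * t) / T t) atTop (nhds (a ^ (-α))))
    (hβ : 0 < β) (hβα : β < α) :
    ∃ C > 0, ∃ w0 > 0, ∀ w ≥ w0, ∀ t ≥ (1/8 : ℝ), T (w * t) ≤ C * t ^ (-β) * T w := by
  have h2 : ∀ᶠ w in atTop, T (2 * w) / T w < (2:ℝ) ^ (-β) := by
    refine (hr 2 (by norm_num)).eventually_lt_const ?_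
    exact Real.rpow_lt_rpow_of_exponent_lt (by norm_num) (by linarith)
  have h8 : ∀ᶠ w in atTop, T ((1/8) * w) / T w < (1/8:ℝ) ^ (-α) + 1 :=
    (hr (1/8) (by norm_num)).eventually_lt_const (by linarith)
  obtain ⟨a, ha⟩ := eventually_atTop.1 h2
  obtain ⟨b, hb⟩ := eventually_atTop.1 h8
  have hρ : (0:ℝ) ≤ 2 ^ (-β) := by positivity
  have key := fun n => aux_potter_iter (T := T) (w0 := max a 1) hρ (by positivity) (fun w hw => by
    have := ha w (le_trans (le_max_left _ _) hw)
    rw [div_lt_iff₀ (hpos w)] at this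
    exact this.le) n
  set K := (1/8:ℝ) ^ (-α) + 1 with hK
  have hKpos : 0 < K := by positivity
  refine ⟨2 ^ β * 8 ^ (-β) * K, by positivity, max (8 * max a 1) (max b 1), by positivity, ?_⟩
  intro w hw t ht
  have hw1 : max a 1 ≤ w / 8 := by
    have := (le_max_left _ _).trans hw
    linarith
  have hw2 : b ≤ w := ((le_max_left _ _).trans (le_max_right _ _)).trans hw
  have hwp : 0 < w := by
    have := ((le_max_right b 1).trans (le_max_right _ _)).trans hw
    linarith
  obtain ⟨n, hn1, hn2⟩ := aux_dyadic (t := 8 * t) (by linarith)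
  have e1 : T (w * t) ≤ T (2 ^ n * (w/8)) := by
    apply hanti
    have := mul_le_mul_of_nonneg_right hn1 (by positivity : 0 ≤ w/8)
    linarith
  have e2 := key n (w/8) hw1
  have e3 : T (w/8) ≤ K * T w := by
    have := hb w hw2
    rw [div_lt_iff₀ (hpos w)] at this
    rw [show w/8 = 1/8*w by ring]
    exact this.le
  have e4 : ((2:ℝ) ^ (-β)) ^ n ≤ 2 ^ β * 8 ^ (-β) * t ^ (-β) := by
    rw [aux_rpow_pow]
    have : ((2:ℝ) ^ (n+1)) ^ (-β) ≤ (8 * t) ^ (-β) :=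
      Real.rpow_le_rpow_of_nonpos (by linarith) hn2.le (by linarith)
    rw [Real.mul_rpow (by norm_num) (by linarith), pow_succ, Real.mul_rpow (by positivity) (by norm_num)] at this
    have h2β : (2:ℝ) ^ β * 2 ^ (-β) = 1 := by
      rw [← Real.rpow_add (by norm_num)]; simp
    calc ((2:ℝ) ^ n) ^ (-β) = 2 ^ β * (((2:ℝ) ^ n) ^ (-β) * 2 ^ (-β)) := by
          rw [mul_left_comm, h2β, mul_one]
      _ ≤ 2 ^ β * (8 ^ (-β) * t ^ (-β)) := by gcongr
      _ = _ := by ring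
  have htp : 0 ≤ t ^ (-β) := Real.rpow_nonneg (by linarith) _
  calc T (w * t) ≤ _ := e1
    _ ≤ _ := e2
    _ ≤ (2 ^ β * 8 ^ (-β) * t ^ (-β)) * (K * T w) := by
      apply mul_le_mul e4 e3 (hpos _).le (by positivity)
    _ = _ := by ring

lemma aux_lower {T : ℝ → ℝ} {α : ℝ} (hα : 0 < α) (hanti : Antitone T) (hpos : ∀ x, 0 < T x)
    (hr : ∀ a > 0, Tendsto (fun t => T (a * t) / T t) atTop (nhds (a ^ (-α)))) :
    ∃ C > 0, ∃ w0 ≥ 1, ∀ w ≥ w0, C * w ^ (-(α+1)) ≤ T w := by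
  have h2 : ∀ᶠ w in atTop, (2:ℝ) ^ (-(α+1)) < T (2 * w) / T w := by
    refine (hr 2 (by norm_num)).eventually_const_lt ?_
    exact Real.rpow_lt_rpow_of_exponent_lt (by norm_num) (by linarith)
  obtain ⟨a, ha⟩ := eventually_atTop.1 h2
  set a' := max a 1 with ha'
  have ha1 : 1 ≤ a' := le_max_right _ _
  have hρ : (0:ℝ) ≤ 2 ^ (-(α+1)) := by positivity
  have key := fun n => aux_potter_iter_lower (T := T) (w0 := a') hρ (by linarith) (fun w hw => by
    have := ha w (le_trans (le_max_left _ _) hw)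
    rw [lt_div_iff₀ (hpos w)] at this
    exact this.le) n
  refine ⟨(2:ℝ) ^ (-(α+1)) * T a', by have := hpos a'; positivity, a', ha1, ?_⟩
  intro w hw
  obtain ⟨n, hn1, hn2⟩ := aux_dyadic (t := w / a') (by rw [le_div_iff₀ (by linarith)]; linarith)
  have e1 := key (n+1) a' le_rfl
  have e2 : T (2 ^ (n+1) * a') ≤ T w := by
    apply hanti
    rw [div_lt_iff₀ (by linarith)] at hn2
    exact hn2.le
  rw [aux_rpow_pow, pow_succ, Real.mul_rpow (by positivity) (by norm_num)] at e1
  have e3 : w ^ (-(α+1)) ≤ ((2:ℝ) ^ n) ^ (-(α+1)) := by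
    apply Real.rpow_le_rpow_of_nonpos (by positivity) _ (by linarith)
    refine hn1.trans ?_
    exact div_le_self (by linarith) ha1
  calc (2:ℝ) ^ (-(α+1)) * T a' * w ^ (-(α+1)) ≤ (2:ℝ) ^ (-(α+1)) * T a' * ((2:ℝ) ^ n) ^ (-(α+1)) := by
        have := (hpos a').le
        gcongr
    _ = ((2:ℝ) ^ n) ^ (-(α+1)) * (2:ℝ) ^ (-(α+1)) * T a' := by ring
    _ ≤ _ := e1
    _ ≤ _ := e2

/-- Convergence of closed tails at asymptotically linear thresholds. -/
lemma aux_tail_tendsto {ι : Type*} {L : Filter ι} {T Tc : ℝ → ℝ} {α : ℝ} (hpos : ∀ x, 0 < T x)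
    (hanti : Antitone T)
    (hr : ∀ a > 0, Tendsto (fun t => T (a * t) / T t) atTop (nhds (a ^ (-α))))
    (hTc1 : ∀ b, T b ≤ Tc b) (hTc2 : ∀ b' b, b' < b → Tc b ≤ T b')
    {w b : ι → ℝ} {m : ℝ} (hm : 0 < m) (hw : Tendsto w L atTop)
    (hb : Tendsto (fun i => b i / w i) L (nhds m)) :
    Tendsto (fun i => Tc (b i) / T (w i)) L (nhds (m ^ (-α))) := by
  have hcont : ContinuousAt (fun x : ℝ => x ^ (-α)) m :=
    Real.continuousAt_rpow_const _ _ (Or.inl hm.ne')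
  have hwp : ∀ᶠ i in L, 0 < w i := hw.eventually_gt_atTop 0
  rw [tendsto_order]
  constructor
  · intro c hc
    have h1 : ∀ᶠ x in nhdsWithin m (Ioi m), c < x ^ (-α) ∧ m < x :=
      (((hcont.tendsto.eventually_const_lt hc).filter_mono nhdsWithin_le_nhds)).and
        self_mem_nhdsWithin
    obtain ⟨m', hm1, hm2⟩ := h1.exists
    have h2 := ((hr m' (by linarith)).comp hw).eventually_const_lt hm1
    filter_upwards [h2, hwp, hb.eventually_lt_const hm2] with i hi hwi hbi
    refine hi.trans_le ?_
    simp only [Function.comp]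
    have := hpos (w i)
    gcongr
    rw [div_lt_iff₀ hwi] at hbi
    exact (hanti hbi.le).trans (hTc1 _)
  · intro c hc
    have h1 : ∀ᶠ x in nhdsWithin m (Iio m), (x ^ (-α) < c ∧ 0 < x) ∧ x < m :=
      (((hcont.tendsto.eventually_lt_const hc).and (lt_mem_nhds hm)).filter_mono
        nhdsWithin_le_nhds).and self_mem_nhdsWithin
    obtain ⟨m', ⟨hm1, hm0⟩, hm2⟩ := h1.exists
    have h2 := ((hr m' hm0).comp hw).eventually_lt_const hm1
    filter_upwards [h2, hwp, hb.eventually_const_lt hm2] with i hi hwi hbi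
    refine lt_of_le_of_lt ?_ hi
    simp only [Function.comp]
    have := hpos (w i)
    gcongr
    rw [lt_div_iff₀ hwi] at hbi
    exact hTc2 _ _ hbi

end RegVar

section Geometry

lemma norm_e1 {d : ℕ} (hd : 0 < d) : ‖e1 d‖ = 1 := by
  unfold e1
  rw [dif_pos hd]
  simp

lemma measurable_interVol (d : ℕ) :
    Measurable (fun p : Euc d × ℝ × Euc d × ℝ => interVol d p.1 p.2.1 p.2.2.1 p.2.2.2) := by
  unfold interVol
  have hS : MeasurableSet {q : (Euc d × ℝ × Euc d × ℝ) × Euc d |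
      dist q.2 q.1.1 ≤ q.1.2.1 ∧ dist q.2 q.1.2.2.1 ≤ q.1.2.2.2} := by
    rw [ofPred_and]
    exact (measurableSet_le (by fun_prop) (by fun_prop)).inter
      (measurableSet_le (by fun_prop) (by fun_prop))
  have := measurable_measure_prodMk_left (ν := (volume : Measure (Euc d))) hS
  exact this.ennreal_toReal

lemma fubini_balls {d : ℕ} (ν : Measure ℝ) [SFinite ν] (x y : Euc d) (r₁ r₂ : ℝ) :
    ∫⁻ s, volume (closedBall x (r₁ + s) ∩ closedBall y (r₂ + s)) ∂ν =
      ∫⁻ p : Euc d, ν (Ici (max (dist p x - r₁) (dist p y - r₂))) := by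
  set S : Set (ℝ × Euc d) := {q | dist q.2 x ≤ r₁ + q.1 ∧ dist q.2 y ≤ r₂ + q.1} with hS
  have hSm : MeasurableSet S := by
    rw [hS, ofPred_and]
    exact (measurableSet_le (by fun_prop) (by fun_prop)).inter
      (measurableSet_le (by fun_prop) (by fun_prop))
  have h1 := Measure.prod_apply (μ := ν) (ν := (volume : Measure (Euc d))) hSm
  have h2 := Measure.prod_apply_symm (μ := ν) (ν := (volume : Measure (Euc d))) hSm
  rw [h1] at h2
  refine Eq.trans ?_ (h2.trans ?_)
  · rfl
  · refine lintegral_congr fun p => ?_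
    congr 1
    ext s
    simp [hS, add_comm]

lemma ballInter_ne_top {d : ℕ} (x y : Euc d) (r s : ℝ) :
    volume (closedBall x r ∩ closedBall y s) ≠ ⊤ :=
  ((measure_mono inter_subset_left).trans_lt measure_closedBall_lt_top).ne

lemma interVol_nonneg (d : ℕ) (x y : Euc d) (r s : ℝ) : 0 ≤ interVol d x r y s :=
  ENNReal.toReal_nonneg

lemma ballVol_nonneg (d : ℕ) (r : ℝ) : 0 ≤ ballVol d r := ENNReal.toReal_nonneg

lemma ballVol_center {d : ℕ} (x : Euc d) (r : ℝ) :
    (volume (closedBall x r)).toReal = ballVol d r := by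
  unfold ballVol
  rw [Measure.addHaar_closedBall_center]

lemma ballVol_eq {d : ℕ} {r : ℝ} (hr : 0 ≤ r) : ballVol d r = ballVol d 1 * r ^ d := by
  unfold ballVol
  rw [Measure.addHaar_closedBall' _ _ hr, ENNReal.toReal_mul, ENNReal.toReal_ofReal (by positivity),
    finrank_euclideanSpace_fin, mul_comm]

lemma ballVol_one_pos (d : ℕ) : 0 < ballVol d 1 := by
  unfold ballVol
  exact ENNReal.toReal_pos (measure_closedBall_pos _ _ one_pos).ne' measure_closedBall_lt_top.ne

lemma interVol_le_left (d : ℕ) (x y : Euc d) (r s : ℝ) : interVol d x r y s ≤ ballVol d r := by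
  rw [← ballVol_center x]
  exact ENNReal.toReal_mono measure_closedBall_lt_top.ne (measure_mono inter_subset_left)

lemma interVol_le_right (d : ℕ) (x y : Euc d) (r s : ℝ) : interVol d x r y s ≤ ballVol d s := by
  rw [← ballVol_center y]
  exact ENNReal.toReal_mono measure_closedBall_lt_top.ne (measure_mono inter_subset_right)

lemma interVol_eq_zero {d : ℕ} {x y : Euc d} {r s : ℝ} (h : r + s < dist x y) :
    interVol d x r y s = 0 := by
  unfold interVol
  rw [(closedBall_disjoint_closedBall h).inter_eq]
  simp

/-- Integral of intersection volumes. -/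
lemma integral_interVol {d : ℕ} (r₁ r₂ : ℝ) :
    ∫ x : Euc d, interVol d 0 r₁ x r₂ = ballVol d r₁ * ballVol d r₂ := by
  set S : Set (Euc d × Euc d) := {q | dist q.2 0 ≤ r₁ ∧ dist q.2 q.1 ≤ r₂} with hS
  have hSm : MeasurableSet S := by
    rw [hS, ofPred_and]
    exact (measurableSet_le (by fun_prop) (by fun_prop)).inter
      (measurableSet_le (by fun_prop) (by fun_prop))
  have h1 := Measure.prod_apply (μ := (volume : Measure (Euc d)))
    (ν := (volume : Measure (Euc d))) hSm
  have h2 := Measure.prod_apply_symm (μ := (volume : Measure (Euc d)))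
    (ν := (volume : Measure (Euc d))) hSm
  rw [h1] at h2
  have h3 : ∀ y : Euc d, volume ((fun x : Euc d => (x, y)) ⁻¹' S) =
      (closedBall (0 : Euc d) r₁).indicator
        (fun _ => volume (closedBall (0 : Euc d) r₂)) y := by
    intro y
    by_cases hy : y ∈ closedBall (0 : Euc d) r₁
    · rw [indicator_of_mem hy, ← Measure.addHaar_closedBall_center volume y]
      congr 1
      ext x
      simp only [mem_closedBall] at hy
      simp only [hS, mem_preimage, mem_ofPred_eq, mem_closedBall, dist_comm x y]
      exact and_iff_right hy
    · rw [indicator_of_notMem hy]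
      have : ((fun x : Euc d => (x, y)) ⁻¹' S) = ∅ := by
        ext x
        simp only [mem_closedBall] at hy
        simp [hS]
        intro h
        exact absurd (by simpa using h) hy
      rw [this, measure_empty]
  simp_rw [h3] at h2
  rw [lintegral_indicator measurableSet_closedBall, lintegral_const] at h2
  have h4 : ∀ x : Euc d, interVol d 0 r₁ x r₂ = (volume (Prod.mk x ⁻¹' S)).toReal := by
    intro x
    unfold interVol
    congr 2
  simp_rw [h4]
  rw [integral_toReal (measurable_measure_prodMk_left hSm).aemeasurable, h2]
  · simp [ballVol, mul_comm]
  · refine Eventually.of_forall (fun x => ?_)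
    exact (ballInter_ne_top (0 : Euc d) x r₁ r₂).lt_top

/-- max distance of `y` to the two centres -/
def mF (d : ℕ) (y : Euc d) : ℝ := max ‖y‖ ‖y - e1 d‖

lemma mF_ge_half {d : ℕ} (hd : 0 < d) (y : Euc d) : 1 / 2 ≤ mF d y := by
  unfold mF
  have h1 : ‖e1 d‖ ≤ ‖y‖ + ‖y - e1 d‖ := by
    calc ‖e1 d‖ = ‖y - (y - e1 d)‖ := by congr 1; abel
      _ ≤ _ := norm_sub_le _ _
  rw [norm_e1 hd] at h1
  rcases le_total (1/2) ‖y‖ with h | h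
  · exact h.trans (le_max_left _ _)
  · exact le_trans (by linarith) (le_max_right _ _)

lemma mF_ge_norm {d : ℕ} (hd : 0 < d) (y : Euc d) : (1 + ‖y‖) / 3 ≤ mF d y := by
  have h1 := mF_ge_half hd y
  have h2 : ‖y‖ ≤ mF d y := le_max_left _ _
  linarith

lemma mF_cont (d : ℕ) : Continuous (mF d) := by
  unfold mF; fun_prop

lemma mF_rpow_integrable {d : ℕ} (hd : 0 < d) {β : ℝ} (hβ : (d:ℝ) < β) :
    Integrable (fun y : Euc d => (mF d y) ^ (-β)) := by
  have h0 : Integrable (fun y : Euc d => (1 + ‖y‖) ^ (-β)) := by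
    apply integrable_one_add_norm
    simpa using hβ
  refine (h0.const_mul ((3:ℝ) ^ β)).mono' ?_ ?_
  · exact (((mF_cont d).measurable).pow_const _).aestronglyMeasurable
  · refine Eventually.of_forall (fun y => ?_)
    have hm := mF_ge_half hd y
    have hn := norm_nonneg y
    have hβ0 : 0 ≤ β := (Nat.cast_nonneg d).trans hβ.le
    rw [Real.norm_of_nonneg (Real.rpow_nonneg (by linarith) _)]
    calc mF d y ^ (-β) ≤ ((1 + ‖y‖) / 3) ^ (-β) :=
          Real.rpow_le_rpow_of_nonpos (by positivity) (mF_ge_norm hd y) (by linarith)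
      _ = _ := by
        rw [div_eq_mul_inv, Real.mul_rpow (by positivity) (by norm_num),
          Real.inv_rpow (by norm_num), Real.rpow_neg (by norm_num : (0:ℝ) ≤ 3), inv_inv, mul_comm]

lemma mF_rpow_integral_pos {d : ℕ} (hd : 0 < d) {β : ℝ} (hβ : (d:ℝ) < β) :
    0 < ∫ y : Euc d, (mF d y) ^ (-β) := by
  have hp : ∀ y : Euc d, 0 < mF d y ^ (-β) := fun y =>
    Real.rpow_pos_of_pos (by linarith [mF_ge_half hd y]) _
  rw [integral_pos_iff_support_of_nonneg (fun y => (hp y).le) (mF_rpow_integrable hd hβ)]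
  have : Function.support (fun y : Euc d => mF d y ^ (-β)) = univ := by
    ext y; simp [(hp y).ne']
  rw [this]
  exact Measure.measure_univ_pos.2 (NeZero.ne _)

lemma cconst_eq {d : ℕ} (hd : 0 < d) {α : ℝ} (hα : (d:ℝ) < α) :
    cconst d α = ∫ y : Euc d, (mF d y) ^ (-α) := by
  have hα0 : 0 < α := (Nat.cast_nonneg d).trans_lt hα
  set f : ℝ → ENNReal := fun r => ENNReal.ofReal (α * r ^ (-α - 1)) with hf
  have hfm : Measurable f := by
    apply Measurable.ennreal_ofReal
    exact (measurable_id.pow_const _).const_mul _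
  set ν : Measure ℝ := (volume.restrict (Ioi 0)).withDensity f with hν
  have hVm : Measurable (fun r : ℝ => volume (closedBall (0 : Euc d) r ∩ closedBall (e1 d) r)) := by
    have hS : MeasurableSet {q : ℝ × Euc d | dist q.2 0 ≤ q.1 ∧ dist q.2 (e1 d) ≤ q.1} := by
      rw [ofPred_and]
      exact (measurableSet_le (by fun_prop) (by fun_prop)).inter
        (measurableSet_le (by fun_prop) (by fun_prop))
    exact measurable_measure_prodMk_left (ν := (volume : Measure (Euc d))) hS
  have hfub := fubini_balls (d := d) ν 0 (e1 d) 0 0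
  simp only [zero_add, sub_zero] at hfub
  have hl : ∫⁻ s, volume (closedBall (0 : Euc d) s ∩ closedBall (e1 d) s) ∂ν =
      ∫⁻ r in Ioi (0:ℝ), ENNReal.ofReal (interVol d 0 r (e1 d) r * (α * r ^ (-α - 1))) := by
    rw [hν, lintegral_withDensity_eq_lintegral_mul _ hfm hVm]
    apply lintegral_congr
    intro r
    simp only [Pi.mul_apply, hf]
    rw [ENNReal.ofReal_mul (interVol_nonneg ..), interVol, ENNReal.ofReal_toReal (ballInter_ne_top _ _ _ _),
      mul_comm]
  have hr : ∀ p : Euc d, ν (Ici (max (dist p 0) (dist p (e1 d)))) =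
      ENNReal.ofReal (mF d p ^ (-α)) := by
    intro p
    have : max (dist p 0) (dist p (e1 d)) = mF d p := by
      simp [mF, dist_eq_norm]
    rw [this]
    have hm : 0 < mF d p := by linarith [mF_ge_half hd p]
    rw [hν, withDensity_apply _ measurableSet_Ici, Measure.restrict_restrict measurableSet_Ici,
      inter_eq_left.2 (Ici_subset_Ioi.2 hm), setLIntegral_congr Ioi_ae_eq_Ici.symm]
    have hi := (integrableOn_Ioi_rpow_of_lt (a := -α - 1) (by linarith) hm).const_mul α
    rw [hf, ← ofReal_integral_eq_lintegral_ofReal hi]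
    · rw [integral_const_mul, integral_Ioi_rpow_of_lt (by linarith) hm]
      congr 1
      rw [show -α - 1 + 1 = -α by ring]
      field_simp
    · refine (ae_restrict_iff' measurableSet_Ioi).2 (Eventually.of_forall fun x hx => ?_)
      have : 0 < x := hm.trans hx
      simp only [Pi.zero_apply]
      positivity
  rw [hl] at hfub
  simp_rw [hr] at hfub
  unfold cconst
  rw [integral_eq_lintegral_of_nonneg_ae, integral_eq_lintegral_of_nonneg_ae, hfub]
  · refine Eventually.of_forall fun y => ?_
    exact Real.rpow_nonneg (by linarith [mF_ge_half hd y]) _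
  · exact (mF_rpow_integrable hd hα).aestronglyMeasurable
  · refine (ae_restrict_iff' measurableSet_Ioi).2 (Eventually.of_forall fun x hx => ?_)
    have : (0:ℝ) < x := hx
    have := interVol_nonneg d 0 (e1 d) x x
    simp only [Pi.zero_apply]
    positivity
  · apply Measurable.aestronglyMeasurable
    have h1 : Measurable fun r : ℝ => interVol d 0 r (e1 d) r := hVm.ennreal_toReal
    exact h1.mul ((measurable_id.pow_const _).const_mul _)

end Geometry

section TailPart

/-- closed tail -/
def tailC (F : Measure ℝ) (b : ℝ) : ℝ := (F (Ici b)).toReal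

/-- the expected intersection volume -/
def IF (d : ℕ) (F : Measure ℝ) (u r₁ r₂ : ℝ) : ℝ :=
  ∫ s, interVol d 0 (r₁ + s) (u • e1 d) (r₂ + s) ∂F

/-- threshold radius -/
def bF (d : ℕ) (w u r₁ r₂ : ℝ) (y : Euc d) : ℝ :=
  max (‖w • y‖ - r₁) (‖w • y - u • e1 d‖ - r₂)

lemma tailF_anti (F : Measure ℝ) [IsProbabilityMeasure F] : Antitone (tailF F) := by
  intro a b hab
  exact ENNReal.toReal_mono (measure_ne_top _ _) (measure_mono (Ioi_subset_Ioi hab))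

lemma tailF_nonneg (F : Measure ℝ) (x : ℝ) : 0 ≤ tailF F x := ENNReal.toReal_nonneg

lemma tailC_nonneg (F : Measure ℝ) (x : ℝ) : 0 ≤ tailC F x := ENNReal.toReal_nonneg

lemma tailC_anti (F : Measure ℝ) [IsProbabilityMeasure F] : Antitone (tailC F) := by
  intro a b hab
  exact ENNReal.toReal_mono (measure_ne_top _ _) (measure_mono (Ici_subset_Ici.2 hab))

lemma tailC_ge (F : Measure ℝ) [IsProbabilityMeasure F] (b : ℝ) : tailF F b ≤ tailC F b :=
  ENNReal.toReal_mono (measure_ne_top _ _) (measure_mono Ioi_subset_Ici_self)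

lemma tailC_le (F : Measure ℝ) [IsProbabilityMeasure F] (b' b : ℝ) (h : b' < b) :
    tailC F b ≤ tailF F b' :=
  ENNReal.toReal_mono (measure_ne_top _ _) (measure_mono (Ici_subset_Ioi.2 h))

lemma tailF_pos {F : Measure ℝ} [IsProbabilityMeasure F] {α : ℝ} {ℓ : ℝ → ℝ}
    (hℓ : SlowlyVarying ℓ) (htail : ∀ x > 0, tailF F x = ℓ x * x ^ (-α)) (x : ℝ) :
    0 < tailF F x := by
  have h1 : 0 < max x 1 := by positivity
  refine lt_of_lt_of_le ?_ (tailF_anti F (le_max_left x 1))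
  rw [htail _ h1]
  exact mul_pos (hℓ.2.1 _ h1) (Real.rpow_pos_of_pos h1 _)

lemma tailF_ratio {F : Measure ℝ} {α : ℝ} {ℓ : ℝ → ℝ}
    (hℓ : SlowlyVarying ℓ) (htail : ∀ x > 0, tailF F x = ℓ x * x ^ (-α)) (a : ℝ) (ha : a > 0) :
    Tendsto (fun t => tailF F (a * t) / tailF F t) atTop (nhds (a ^ (-α))) := by
  have h := (hℓ.2.2 a ha).mul_const (a ^ (-α))
  rw [one_mul] at h
  refine h.congr' ?_
  filter_upwards [eventually_gt_atTop 0] with t ht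
  rw [htail _ (by positivity), htail _ ht, Real.mul_rpow ha.le ht.le]
  have := hℓ.2.1 t ht
  have := Real.rpow_pos_of_pos ht (-α)
  field_simp

lemma IF_eq {d : ℕ} (F : Measure ℝ) [IsProbabilityMeasure F] {w : ℝ} (hw : 0 < w) (u r₁ r₂ : ℝ) :
    IF d F u r₁ r₂ = w ^ d * ∫ y : Euc d, tailC F (bF d w u r₁ r₂ y) := by
  have h0 := fubini_balls (d := d) F 0 (u • e1 d) r₁ r₂
  have hanti : Antitone (fun b : ℝ => F (Ici b)) := fun a b hab =>
    measure_mono (Ici_subset_Ici.2 hab)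
  have h1 : IF d F u r₁ r₂ =
      ∫ p : Euc d, tailC F (max (dist p 0 - r₁) (dist p (u • e1 d) - r₂)) := by
    unfold IF interVol tailC
    rw [integral_toReal, integral_toReal, h0]
    · refine (hanti.measurable.comp ?_).aemeasurable
      fun_prop
    · exact Eventually.of_forall fun p => measure_lt_top _ _
    · have hS : MeasurableSet {q : ℝ × Euc d | dist q.2 0 ≤ r₁ + q.1 ∧
          dist q.2 (u • e1 d) ≤ r₂ + q.1} := by
        rw [ofPred_and]
        exact (measurableSet_le (by fun_prop) (by fun_prop)).inter
          (measurableSet_le (by fun_prop) (by fun_prop))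
      exact (measurable_measure_prodMk_left (ν := (volume : Measure (Euc d))) hS).aemeasurable
    · exact Eventually.of_forall fun p => (ballInter_ne_top _ _ _ _).lt_top
  rw [h1]
  have h2 := Measure.integral_comp_smul (volume : Measure (Euc d))
    (fun p : Euc d => tailC F (max (dist p 0 - r₁) (dist p (u • e1 d) - r₂))) w
  have h3 : ∀ y : Euc d, tailC F (max (dist (w • y) 0 - r₁) (dist (w • y) (u • e1 d) - r₂)) =
      tailC F (bF d w u r₁ r₂ y) := by
    intro y
    simp [bF, dist_eq_norm]
  simp_rw [h3] at h2
  rw [h2, finrank_euclideanSpace_fin, abs_of_nonneg (by positivity), smul_eq_mul,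
    mul_inv_cancel_left₀ (by positivity)]

lemma bF_ge {d : ℕ} (hd : 0 < d) {w u r₁ r₂ : ℝ} (hw : 0 < w) (h1 : 0 ≤ r₁) (h2 : 0 ≤ r₂)
    (h : r₁ + r₂ + |u - w| ≤ w / 4) (y : Euc d) : w * mF d y / 2 ≤ bF d w u r₁ r₂ y := by
  have hm := mF_ge_half hd y
  have hwm : w / 4 ≤ w * mF d y / 2 := by nlinarith
  have hu := abs_nonneg (u - w)
  have e1' : ‖w • y‖ = w * ‖y‖ := by rw [norm_smul, Real.norm_of_nonneg hw.le]
  have e2 : w * ‖y - e1 d‖ ≤ ‖w • y - u • e1 d‖ + |u - w| := by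
    have : w • (y - e1 d) = (w • y - u • e1 d) + (u - w) • e1 d := by
      rw [smul_sub, sub_smul]; abel
    calc w * ‖y - e1 d‖ = ‖w • (y - e1 d)‖ := by rw [norm_smul, Real.norm_of_nonneg hw.le]
      _ ≤ ‖w • y - u • e1 d‖ + ‖(u - w) • e1 d‖ := by rw [this]; exact norm_add_le _ _
      _ = _ := by rw [norm_smul, norm_e1 hd, mul_one, Real.norm_eq_abs]
  unfold bF
  rcases max_choice ‖y‖ ‖y - e1 d‖ with hc | hc
  · refine le_trans ?_ (le_max_left _ _)
    have : mF d y = ‖y‖ := hc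
    rw [this] at hwm ⊢
    rw [e1']
    linarith
  · refine le_trans ?_ (le_max_right _ _)
    have : mF d y = ‖y - e1 d‖ := hc
    rw [this] at hwm ⊢
    linarith

lemma bF_tendsto {ι : Type*} {L : Filter ι} {d : ℕ} {w u : ι → ℝ} (hw : Tendsto w L atTop)
    (hu : Tendsto (fun i => u i / w i) L (nhds 1)) (r₁ r₂ : ℝ) (y : Euc d) :
    Tendsto (fun i => bF d (w i) (u i) r₁ r₂ y / w i) L (nhds (mF d y)) := by
  have k1 : Tendsto (fun i => r₁ / w i) L (nhds 0) := hw.const_div_atTop r₁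
  have k2 : Tendsto (fun i => r₂ / w i) L (nhds 0) := hw.const_div_atTop r₂
  have k3 : Tendsto (fun i => max (‖y‖ - r₁ / w i) (‖y - (u i / w i) • e1 d‖ - r₂ / w i)) L
      (nhds (max (‖y‖ - 0) (‖y - (1:ℝ) • e1 d‖ - 0))) := by
    refine Tendsto.max (tendsto_const_nhds.sub k1) (Tendsto.sub ?_ k2)
    exact (tendsto_const_nhds.sub (hu.smul_const (e1 d))).norm
  simp only [sub_zero, one_smul] at k3
  refine k3.congr' ?_
  filter_upwards [hw.eventually_gt_atTop 0] with i hi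
  unfold bF
  rw [← max_div_div_right hi.le]
  congr 1
  · rw [norm_smul, Real.norm_of_nonneg hi.le]
    field_simp
  · have : w i • y - u i • e1 d = w i • (y - (u i / w i) • e1 d) := by
      rw [smul_sub, smul_smul, mul_div_cancel₀ _ hi.ne']
    rw [this, norm_smul, Real.norm_of_nonneg hi.le]
    field_simp

/-- pointwise Potter domination -/
lemma tailC_bF_bound {d : ℕ} (hd : 0 < d) {F : Measure ℝ} [IsProbabilityMeasure F]
    {α : ℝ} (hα : (d : ℝ) < α) (hpos : ∀ x, 0 < tailF F x)
    (hr : ∀ a > 0, Tendsto (fun t => tailF F (a * t) / tailF F t) atTop (nhds (a ^ (-α)))) :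
    ∃ β, (d:ℝ) < β ∧ β < α ∧ ∃ C > 0, ∃ w0 ≥ 1, ∀ w ≥ w0, ∀ u r₁ r₂ : ℝ, 0 ≤ r₁ → 0 ≤ r₂ →
      r₁ + r₂ + |u - w| ≤ w / 4 → ∀ y : Euc d,
      tailC F (bF d w u r₁ r₂ y) ≤ C * mF d y ^ (-β) * tailF F w := by
  have hd0 : (0:ℝ) < d := by exact_mod_cast hd
  obtain ⟨C, hC, w0, hw0, H⟩ := aux_potter (β := (d + α) / 2) (tailF_anti F) hpos hr
    (by linarith) (by linarith)
  refine ⟨(d + α) / 2, by linarith, by linarith, C * (1/4) ^ (-((d + α) / 2)), by positivity,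
    max w0 1, le_max_right _ _, ?_⟩
  intro w hw u r₁ r₂ h1 h2 h y
  have hwp : 0 < w := lt_of_lt_of_le one_pos ((le_max_right _ _).trans hw)
  have hm := mF_ge_half hd y
  have k1 := bF_ge hd hwp h1 h2 h y
  have k2 : tailC F (bF d w u r₁ r₂ y) ≤ tailF F (w * (mF d y / 4)) :=
    tailC_le F _ _ (lt_of_lt_of_le (by nlinarith) k1)
  have k3 := H w ((le_max_left _ _).trans hw) (mF d y / 4) (by linarith)
  refine k2.trans (k3.trans (le_of_eq ?_))
  rw [div_eq_mul_one_div, Real.mul_rpow (by linarith) (by norm_num)]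
  ring

lemma IF_bound {d : ℕ} (hd : 0 < d) {F : Measure ℝ} [IsProbabilityMeasure F]
    {α : ℝ} (hα : (d : ℝ) < α) (hpos : ∀ x, 0 < tailF F x)
    (hr : ∀ a > 0, Tendsto (fun t => tailF F (a * t) / tailF F t) atTop (nhds (a ^ (-α)))) :
    ∃ C > 0, ∃ w0 ≥ 1, ∀ w ≥ w0, ∀ u r₁ r₂ : ℝ, 0 ≤ r₁ → 0 ≤ r₂ →
      r₁ + r₂ + |u - w| ≤ w / 4 → IF d F u r₁ r₂ ≤ C * (w ^ d * tailF F w) := by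
  obtain ⟨β, hβ, -, C, hC, w0, hw0, H⟩ := tailC_bF_bound hd hα hpos hr
  refine ⟨C * ∫ y : Euc d, mF d y ^ (-β), mul_pos hC (mF_rpow_integral_pos hd hβ), w0, hw0, ?_⟩
  intro w hw u r₁ r₂ h1 h2 h
  have hwp : 0 < w := by linarith
  rw [IF_eq F hwp]
  have : ∫ y : Euc d, tailC F (bF d w u r₁ r₂ y) ≤ ∫ y : Euc d, C * mF d y ^ (-β) * tailF F w := by
    refine integral_mono_of_nonneg (Eventually.of_forall fun y => ENNReal.toReal_nonneg) ?_
      (Eventually.of_forall fun y => H w hw u r₁ r₂ h1 h2 h y)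
    exact ((mF_rpow_integrable hd hβ).const_mul C).mul_const _
  rw [integral_mul_const, integral_const_mul] at this
  calc _ ≤ w ^ d * (C * (∫ y : Euc d, mF d y ^ (-β)) * tailF F w) := by gcongr
    _ = _ := by ring

lemma IF_tendsto {ι : Type*} {L : Filter ι} [L.IsCountablyGenerated]
    {d : ℕ} (hd : 0 < d) {F : Measure ℝ} [IsProbabilityMeasure F]
    {α : ℝ} (hα : (d : ℝ) < α) (hpos : ∀ x, 0 < tailF F x)
    (hr : ∀ a > 0, Tendsto (fun t => tailF F (a * t) / tailF F t) atTop (nhds (a ^ (-α))))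
    {w u : ι → ℝ} (hw : Tendsto w L atTop)
    (hu : Tendsto (fun i => u i / w i) L (nhds 1)) {r₁ r₂ : ℝ} (h1 : 0 ≤ r₁) (h2 : 0 ≤ r₂) :
    Tendsto (fun i => IF d F (u i) r₁ r₂ / (w i ^ d * tailF F (w i))) L (nhds (cconst d α)) := by
  obtain ⟨β, hβ, -, C, hC, w0, hw0, H⟩ := tailC_bF_bound hd hα hpos hr
  rw [cconst_eq hd hα]
  have hcond : ∀ᶠ i in L, r₁ + r₂ + |u i - w i| ≤ w i / 4 := by
    have k : Tendsto (fun i => (r₁ + r₂) / w i + |u i / w i - 1|) L (nhds (0 + |(1:ℝ) - 1|)) :=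
      (hw.const_div_atTop _).add ((hu.sub_const 1).abs)
    simp only [sub_self, abs_zero, add_zero] at k
    filter_upwards [k.eventually_lt_const (show (0:ℝ) < 1/4 by norm_num),
      hw.eventually_gt_atTop 0] with i hi hwi
    have e : |u i / w i - 1| = |u i - w i| / w i := by
      rw [show u i / w i - 1 = (u i - w i) / w i by field_simp, abs_div, abs_of_pos hwi]
    rw [e, ← add_div, div_lt_iff₀ hwi] at hi
    linarith
  have hdct : Tendsto (fun i => ∫ y : Euc d, tailC F (bF d (w i) (u i) r₁ r₂ y) / tailF F (w i)) L
      (nhds (∫ y : Euc d, mF d y ^ (-α))) := by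
    refine tendsto_integral_filter_of_dominated_convergence (fun y => C * mF d y ^ (-β)) ?_ ?_ ?_ ?_
    · refine Eventually.of_forall fun i => ?_
      apply Measurable.aestronglyMeasurable
      refine Measurable.div_const ((tailC_anti F).measurable.comp ?_) _
      unfold bF
      fun_prop
    · filter_upwards [hcond, hw.eventually_ge_atTop w0] with i hi hwi
      refine Eventually.of_forall fun y => ?_
      rw [Real.norm_of_nonneg (div_nonneg (tailC_nonneg F _) (hpos _).le), div_le_iff₀ (hpos _)]
      exact H _ hwi _ _ _ h1 h2 hi y
    · exact (mF_rpow_integrable hd hβ).const_mul C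
    · refine Eventually.of_forall fun y => ?_
      exact aux_tail_tendsto hpos (tailF_anti F) hr (tailC_ge F) (tailC_le F)
        (by linarith [mF_ge_half hd y]) hw (bF_tendsto hw hu r₁ r₂ y)
  refine hdct.congr' ?_
  filter_upwards [hw.eventually_gt_atTop 0] with i hi
  rw [IF_eq F hi, integral_div, mul_div_mul_left _ _ (by positivity)]

end TailPart

section QPart

lemma ae_nonneg_F {F : Measure ℝ} (hsupp : F (Iio 0) = 0) : ∀ᵐ s ∂F, 0 ≤ s := by
  rw [ae_iff]
  convert hsupp using 2
  ext s
  simp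

lemma integrable_shift {d : ℕ} {F : Measure ℝ} [IsProbabilityMeasure F] (hsupp : F (Iio 0) = 0)
    (hmom : Integrable (fun r : ℝ => r ^ d) F) {r : ℝ} (hr : 0 ≤ r) :
    Integrable (fun s : ℝ => (r + s) ^ d) F := by
  refine (((integrable_const (r ^ d)).add hmom).const_mul ((2:ℝ) ^ (d - 1))).mono' ?_ ?_
  · exact Measurable.aestronglyMeasurable (by fun_prop)
  · filter_upwards [ae_nonneg_F hsupp] with s hs
    rw [Real.norm_of_nonneg (by positivity)]
    exact add_pow_le hr hs d

lemma hI_pos (d : ℕ) (lam : ℝ) (F : Measure ℝ) (r : ℝ) : 0 < hI d lam F r := Real.exp_pos _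

lemma hI_le {d : ℕ} {lam : ℝ} (hlam : 0 < lam) {F : Measure ℝ} [IsProbabilityMeasure F]
    (hsupp : F (Iio 0) = 0) (hmom : Integrable (fun r : ℝ => r ^ d) F) {r : ℝ} (hr : 0 ≤ r) :
    hI d lam F r ≤ Real.exp (-(lam * ballVol d 1 * r ^ d)) := by
  unfold hI
  have hb := ballVol_one_pos d
  have : r ^ d ≤ ∫ s, (r + s) ^ d ∂F := by
    calc r ^ d = ∫ s, r ^ d ∂F := by simp
      _ ≤ _ := by
        refine integral_mono_ae (integrable_const _) (integrable_shift hsupp hmom hr) ?_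
        filter_upwards [ae_nonneg_F hsupp] with s hs
        exact pow_le_pow_left₀ hr (by linarith) d
  gcongr

lemma hI_le_one {d : ℕ} {lam : ℝ} (hlam : 0 < lam) {F : Measure ℝ} [IsProbabilityMeasure F]
    (hsupp : F (Iio 0) = 0) (hmom : Integrable (fun r : ℝ => r ^ d) F) {r : ℝ} (hr : 0 ≤ r) :
    hI d lam F r ≤ 1 := by
  refine (hI_le hlam hsupp hmom hr).trans ?_
  have hb := ballVol_one_pos d
  rw [Real.exp_le_one_iff]
  have : 0 ≤ lam * ballVol d 1 * r ^ d := by positivity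
  linarith

lemma IF_nonneg (d : ℕ) (F : Measure ℝ) (u r₁ r₂ : ℝ) : 0 ≤ IF d F u r₁ r₂ :=
  integral_nonneg fun _ => interVol_nonneg ..

lemma IF_le_aux {d : ℕ} {F : Measure ℝ} [IsProbabilityMeasure F]
    (hsupp : F (Iio 0) = 0) (hmom : Integrable (fun r : ℝ => r ^ d) F) {u r₁ r₂ r : ℝ}
    (hr : 0 ≤ r) (h : ∀ s, interVol d 0 (r₁ + s) (u • e1 d) (r₂ + s) ≤ ballVol d (r + s)) :
    IF d F u r₁ r₂ ≤ ballVol d 1 * ∫ s, (r + s) ^ d ∂F := by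
  rw [← integral_const_mul]
  refine integral_mono_of_nonneg (Eventually.of_forall fun s => interVol_nonneg ..)
    ((integrable_shift hsupp hmom hr).const_mul _) ?_
  filter_upwards [ae_nonneg_F hsupp] with s hs
  rw [← ballVol_eq (by linarith)]
  exact h s

lemma hI_mul_exp_left {d : ℕ} {lam : ℝ} (hlam : 0 < lam) {F : Measure ℝ} [IsProbabilityMeasure F]
    (hsupp : F (Iio 0) = 0) (hmom : Integrable (fun r : ℝ => r ^ d) F) {u r₁ r₂ : ℝ}
    (h1 : 0 ≤ r₁) : hI d lam F r₁ * Real.exp (lam * IF d F u r₁ r₂) ≤ 1 := by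
  unfold hI
  rw [← Real.exp_add, Real.exp_le_one_iff]
  have := IF_le_aux (u := u) (r₂ := r₂) hsupp hmom h1 (fun s => interVol_le_left ..)
  nlinarith

lemma hI_mul_exp_right {d : ℕ} {lam : ℝ} (hlam : 0 < lam) {F : Measure ℝ} [IsProbabilityMeasure F]
    (hsupp : F (Iio 0) = 0) (hmom : Integrable (fun r : ℝ => r ^ d) F) {u r₁ r₂ : ℝ}
    (h2 : 0 ≤ r₂) : hI d lam F r₂ * Real.exp (lam * IF d F u r₁ r₂) ≤ 1 := by
  unfold hI
  rw [← Real.exp_add, Real.exp_le_one_iff]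
  have := IF_le_aux (u := u) (r₁ := r₁) hsupp hmom h2 (fun s => interVol_le_right ..)
  nlinarith

lemma qI_of_le {d : ℕ} {lam : ℝ} {F : Measure ℝ} {u r₁ r₂ : ℝ} (h : u ≤ r₁ + r₂) :
    qI d lam F u r₁ r₂ = -(hI d lam F r₁ * hI d lam F r₂) := by
  unfold qI h2I
  rw [if_pos h, zero_sub]

lemma qI_of_lt {d : ℕ} {lam : ℝ} {F : Measure ℝ} {u r₁ r₂ : ℝ} (h : r₁ + r₂ < u) :
    qI d lam F u r₁ r₂ = hI d lam F r₁ * hI d lam F r₂ * (Real.exp (lam * IF d F u r₁ r₂) - 1) := by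
  unfold qI h2I IF
  rw [if_neg (not_le.2 h)]
  ring

lemma qI_abs_le {d : ℕ} {lam : ℝ} (hlam : 0 < lam) {F : Measure ℝ} [IsProbabilityMeasure F]
    (hsupp : F (Iio 0) = 0) (hmom : Integrable (fun r : ℝ => r ^ d) F) {u r₁ r₂ : ℝ}
    (h1 : 0 ≤ r₁) (h2 : 0 ≤ r₂) :
    |qI d lam F u r₁ r₂| ≤ hI d lam F r₁ ∧ |qI d lam F u r₁ r₂| ≤ hI d lam F r₂ := by
  have p1 := hI_pos d lam F r₁
  have p2 := hI_pos d lam F r₂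
  have l1 := hI_le_one hlam hsupp hmom h1
  have l2 := hI_le_one hlam hsupp hmom h2
  rcases le_or_gt u (r₁ + r₂) with h | h
  · rw [qI_of_le h, abs_neg, abs_of_pos (mul_pos p1 p2)]
    constructor <;> nlinarith
  · rw [qI_of_lt h]
    have e1 := hI_mul_exp_left (u := u) (r₂ := r₂) hlam hsupp hmom h1
    have e2 := hI_mul_exp_right (u := u) (r₁ := r₁) hlam hsupp hmom h2
    have hI0 : 1 ≤ Real.exp (lam * IF d F u r₁ r₂) :=
      Real.one_le_exp (mul_nonneg hlam.le (IF_nonneg ..))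
    set E := Real.exp (lam * IF d F u r₁ r₂)
    rw [abs_of_nonneg (mul_nonneg (mul_pos p1 p2).le (by linarith))]
    constructor
    · nlinarith [mul_pos p1 p2]
    · nlinarith [mul_pos p1 p2]

/-- the decay rate -/
def gF (d : ℕ) (F : Measure ℝ) (w : ℝ) : ℝ := w ^ d * tailF F w

lemma gF_pos {d : ℕ} {F : Measure ℝ} (hpos : ∀ x, 0 < tailF F x) {w : ℝ} (hw : 0 < w) :
    0 < gF d F w := mul_pos (pow_pos hw d) (hpos w)

lemma gF_tendsto {d : ℕ} {F : Measure ℝ} [IsProbabilityMeasure F]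
    {α : ℝ} (hα : (d : ℝ) < α) (hpos : ∀ x, 0 < tailF F x)
    (hr : ∀ a > 0, Tendsto (fun t => tailF F (a * t) / tailF F t) atTop (nhds (a ^ (-α)))) :
    Tendsto (gF d F) atTop (nhds 0) := by
  have hd0 : (0:ℝ) ≤ d := Nat.cast_nonneg d
  obtain ⟨C, hC, w0, hw0, H⟩ := aux_potter (β := (d + α) / 2) (tailF_anti F) hpos hr
    (by linarith) (by linarith)
  have hlim : Tendsto (fun w : ℝ => C * (w0⁻¹) ^ (-((d + α) / 2)) * tailF F w0 *
      w ^ (-((α - d) / 2))) atTop (nhds 0) := by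
    have := (tendsto_rpow_neg_atTop (y := (α - d) / 2) (by linarith)).const_mul
      (C * (w0⁻¹) ^ (-((d + α) / 2)) * tailF F w0)
    simpa using this
  refine squeeze_zero' ?_ ?_ hlim
  · filter_upwards [eventually_gt_atTop 0] with w hw
    exact (gF_pos hpos hw).le
  · filter_upwards [eventually_ge_atTop w0] with w hw
    have hwp : 0 < w := by linarith
    have k := H w0 le_rfl (w / w0) (by
      have : 1 ≤ w / w0 := by rw [le_div_iff₀ hw0]; linarith
      linarith)
    rw [mul_div_cancel₀ _ hw0.ne'] at k
    have e : w ^ d * w ^ (-((d + α) / 2)) = w ^ (-((α - d) / 2)) := by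
      rw [← Real.rpow_natCast, ← Real.rpow_add hwp]
      congr 1
      ring
    unfold gF
    calc w ^ d * tailF F w ≤ w ^ d * (C * (w / w0) ^ (-((d + α) / 2)) * tailF F w0) := by gcongr
      _ = C * (w0⁻¹) ^ (-((d + α) / 2)) * tailF F w0 * (w ^ d * w ^ (-((d + α) / 2))) := by
        rw [div_eq_mul_inv, Real.mul_rpow hwp.le (by positivity)]
        ring
      _ = _ := by rw [e]

lemma exp_div_gF_tendsto {d : ℕ} (hd : 0 < d) {F : Measure ℝ} [IsProbabilityMeasure F]
    {α : ℝ} (hα : (d : ℝ) < α) (hpos : ∀ x, 0 < tailF F x)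
    (hr : ∀ a > 0, Tendsto (fun t => tailF F (a * t) / tailF F t) atTop (nhds (a ^ (-α))))
    {b : ℝ} (hb : 0 < b) :
    Tendsto (fun w => Real.exp (-(b * w ^ d)) / gF d F w) atTop (nhds 0) := by
  have hd0 : (0:ℝ) ≤ d := Nat.cast_nonneg d
  obtain ⟨C, hC, w0, hw0, H⟩ := aux_lower (by linarith) (tailF_anti F) hpos hr
  have hlim := (tendsto_rpow_mul_exp_neg_mul_atTop_nhds_zero (α+1) b hb).const_mul C⁻¹
  rw [mul_zero] at hlim
  refine squeeze_zero' ?_ ?_ hlim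
  · filter_upwards [eventually_gt_atTop 0] with w hw
    exact div_nonneg (Real.exp_pos _).le (gF_pos hpos hw).le
  · filter_upwards [eventually_ge_atTop w0] with w hw
    have hw1 : 1 ≤ w := by linarith
    have hwp : 0 < w := by linarith
    have hg : C * w ^ (-(α+1)) ≤ gF d F w := by
      refine (H w hw).trans ?_
      unfold gF
      have : 1 ≤ w ^ d := one_le_pow₀ hw1
      nlinarith [hpos w]
    have hwd : w ≤ w ^ d := le_self_pow₀ hw1 hd.ne'
    have hp := Real.rpow_pos_of_pos hwp (-(α+1))
    calc Real.exp (-(b * w ^ d)) / gF d F w ≤ Real.exp (-b * w) / (C * w ^ (-(α+1))) := by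
          gcongr
          nlinarith
      _ = _ := by
        rw [Real.rpow_neg hwp.le]
        field_simp

set_option maxHeartbeats 1000000 in
lemma qI_bound {d : ℕ} (hd : 0 < d) {lam : ℝ} (hlam : 0 < lam)
    {F : Measure ℝ} [IsProbabilityMeasure F]
    (hsupp : F (Iio 0) = 0) (hmom : Integrable (fun r : ℝ => r ^ d) F)
    {α : ℝ} (hα : (d : ℝ) < α) (hpos : ∀ x, 0 < tailF F x)
    (hr : ∀ a > 0, Tendsto (fun t => tailF F (a * t) / tailF F t) atTop (nhds (a ^ (-α)))) :
    ∃ C > 0, ∃ b > 0, ∃ w0 ≥ 1, ∀ w ≥ w0, ∀ u r₁ r₂ : ℝ, 0 ≤ r₁ → 0 ≤ r₂ →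
      |u - w| ≤ r₁ + r₂ → |qI d lam F u r₁ r₂| ≤
        C * gF d F w * (Real.exp (-(b * r₁ ^ d)) * Real.exp (-(b * r₂ ^ d))) := by
  have ha : 0 < lam * ballVol d 1 := mul_pos hlam (ballVol_one_pos d)
  set a := lam * ballVol d 1 with hadef
  obtain ⟨C1, hC1, w1, hw1, H1⟩ := IF_bound hd hα hpos hr
  have hb' : 0 < a / 2 * (1/16) ^ d := by positivity
  obtain ⟨w2, H2⟩ := eventually_atTop.1
    ((exp_div_gF_tendsto hd hα hpos hr hb').eventually_lt_const one_pos)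
  obtain ⟨w3, H3⟩ := eventually_atTop.1
    ((gF_tendsto hα hpos hr).eventually_lt_const one_pos)
  set K := lam * C1 * Real.exp (lam * C1) with hK
  have hKpos : 0 < K := by positivity
  refine ⟨K + 1, by linarith, a / 4, by positivity, max w1 (max w2 w3),
    hw1.trans (le_max_left _ _), ?_⟩
  intro w hw u r₁ r₂ h1 h2 hu
  have hww1 : w1 ≤ w := (le_max_left _ _).trans hw
  have hww2 : w2 ≤ w := ((le_max_left _ _).trans (le_max_right _ _)).trans hw
  have hww3 : w3 ≤ w := ((le_max_right _ _).trans (le_max_right _ _)).trans hw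
  have hwp : 0 < w := by linarith
  have hg := gF_pos (d := d) hpos hwp
  have p1 := hI_pos d lam F r₁
  have p2 := hI_pos d lam F r₂
  have l1 := hI_le hlam hsupp hmom h1
  have l2 := hI_le hlam hsupp hmom h2
  rw [← hadef] at l1 l2
  have hr1 : 0 ≤ r₁ ^ d := by positivity
  have hr2 : 0 ≤ r₂ ^ d := by positivity
  have hq := qI_abs_le (u := u) hlam hsupp hmom h1 h2
  have large : ∀ M, 0 ≤ M → w / 16 ≤ M → r₁ ≤ M → r₂ ≤ M →
      |qI d lam F u r₁ r₂| ≤ Real.exp (-(a * M ^ d)) → |qI d lam F u r₁ r₂| ≤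
        (K + 1) * gF d F w * (Real.exp (-(a / 4 * r₁ ^ d)) * Real.exp (-(a / 4 * r₂ ^ d))) := by
    intro M hM hwM hr1M hr2M hle
    have m1 : r₁ ^ d ≤ M ^ d := pow_le_pow_left₀ h1 hr1M d
    have m2 : r₂ ^ d ≤ M ^ d := pow_le_pow_left₀ h2 hr2M d
    have m3 : (1/16) ^ d * w ^ d ≤ M ^ d := by
      rw [← mul_pow]
      exact pow_le_pow_left₀ (by positivity) (by linarith) d
    have k2 := H2 w hww2
    rw [div_lt_one hg] at k2
    calc |qI d lam F u r₁ r₂| ≤ _ := hle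
      _ ≤ Real.exp (-(a / 2 * (1/16) ^ d * w ^ d) + (-(a / 4 * r₁ ^ d) + -(a / 4 * r₂ ^ d))) := by
        apply Real.exp_le_exp.2
        nlinarith
      _ = Real.exp (-(a / 2 * (1/16) ^ d * w ^ d)) *
          (Real.exp (-(a / 4 * r₁ ^ d)) * Real.exp (-(a / 4 * r₂ ^ d))) := by
        rw [Real.exp_add, Real.exp_add]
      _ ≤ _ := by
        gcongr
        nlinarith
  by_cases hc1 : w / 16 ≤ r₁
  · rcases le_total r₁ r₂ with hle | hle
    · exact large r₂ h2 (hc1.trans hle) hle le_rfl (hq.2.trans l2)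
    · exact large r₁ h1 hc1 le_rfl hle (hq.1.trans l1)
  by_cases hc2 : w / 16 ≤ r₂
  · rcases le_total r₁ r₂ with hle | hle
    · exact large r₂ h2 hc2 hle le_rfl (hq.2.trans l2)
    · exact large r₁ h1 (hc2.trans hle) le_rfl hle (hq.1.trans l1)
  push Not at hc1 hc2
  have hIF := H1 w hww1 u r₁ r₂ h1 h2 (by linarith)
  have hI0 := IF_nonneg d F u r₁ r₂
  have hult : r₁ + r₂ < u := by
    have := (abs_le.1 hu).1
    linarith
  rw [qI_of_lt hult]
  change IF d F u r₁ r₂ ≤ C1 * gF d F w at hIF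
  set x := lam * IF d F u r₁ r₂ with hx
  have hx0 : 0 ≤ x := mul_nonneg hlam.le hI0
  have hx1 : x ≤ lam * C1 * gF d F w := by nlinarith
  have hx2 : x ≤ lam * C1 := by
    have := H3 w hww3
    have : 0 < lam * C1 := by positivity
    nlinarith
  have hexp : Real.exp x - 1 ≤ x * Real.exp x := by
    have := Real.add_one_le_exp (-x)
    have e : Real.exp (-x) * Real.exp x = 1 := by rw [← Real.exp_add]; simp
    nlinarith [Real.exp_pos x]
  have hexp0 : 0 ≤ Real.exp x - 1 := by linarith [Real.one_le_exp hx0]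
  have hexp2 : Real.exp x - 1 ≤ K * gF d F w := by
    calc _ ≤ _ := hexp
      _ ≤ (lam * C1 * gF d F w) * Real.exp (lam * C1) := by gcongr
      _ = _ := by rw [hK]; ring
  rw [abs_of_nonneg (by positivity)]
  have l1' : hI d lam F r₁ ≤ Real.exp (-(a / 4 * r₁ ^ d)) :=
    l1.trans (Real.exp_le_exp.2 (by nlinarith))
  have l2' : hI d lam F r₂ ≤ Real.exp (-(a / 4 * r₂ ^ d)) :=
    l2.trans (Real.exp_le_exp.2 (by nlinarith))
  calc _ ≤ (Real.exp (-(a / 4 * r₁ ^ d)) * Real.exp (-(a / 4 * r₂ ^ d))) *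
        ((K + 1) * gF d F w) := by
        gcongr
        linarith
    _ = _ := by ring

lemma qI_tendsto {ι : Type*} {L : Filter ι} [L.IsCountablyGenerated]
    {d : ℕ} (hd : 0 < d) {lam : ℝ} {F : Measure ℝ} [IsProbabilityMeasure F]
    {α : ℝ} (hα : (d : ℝ) < α) (hpos : ∀ x, 0 < tailF F x)
    (hr : ∀ a > 0, Tendsto (fun t => tailF F (a * t) / tailF F t) atTop (nhds (a ^ (-α))))
    {w u : ι → ℝ} (hw : Tendsto w L atTop)
    (hu : Tendsto (fun i => u i / w i) L (nhds 1)) {r₁ r₂ : ℝ} (h1 : 0 ≤ r₁) (h2 : 0 ≤ r₂) :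
    Tendsto (fun i => qI d lam F (u i) r₁ r₂ / gF d F (w i)) L
      (nhds (hI d lam F r₁ * hI d lam F r₂ * (lam * cconst d α))) := by
  have k1 := IF_tendsto hd hα hpos hr hw hu h1 h2
  have k2 : Tendsto (fun i => lam * IF d F (u i) r₁ r₂) L (nhds 0) := by
    have := (k1.mul ((gF_tendsto hα hpos hr).comp hw)).const_mul lam
    simp only [mul_zero] at this
    refine this.congr' ?_
    filter_upwards [hw.eventually_gt_atTop 0] with i hi
    have := gF_pos (d := d) hpos hi
    simp only [Function.comp]
    change lam * (IF d F (u i) r₁ r₂ / gF d F (w i) * gF d F (w i)) = _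
    rw [div_mul_cancel₀ _ this.ne']
  have hds : Tendsto (dslope Real.exp 0) (nhds 0) (nhds 1) := by
    have h : ContinuousAt (dslope Real.exp 0) 0 :=
      continuousAt_dslope_same.2 Real.differentiable_exp.differentiableAt
    have h' := h.tendsto
    simpa using h'
  have k3 := ((hds.comp k2).mul (k1.const_mul lam)).const_mul (hI d lam F r₁ * hI d lam F r₂)
  rw [one_mul] at k3
  refine k3.congr' ?_
  have hult : ∀ᶠ i in L, r₁ + r₂ < u i := by
    have : Tendsto u L atTop := by
      have := hu.pos_mul_atTop one_pos hw
      refine this.congr' ?_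
      filter_upwards [hw.eventually_gt_atTop 0] with i hi
      field_simp
    exact this.eventually_gt_atTop _
  filter_upwards [hult] with i hi
  rw [qI_of_lt hi]
  have e := sub_smul_dslope Real.exp 0 (lam * IF d F (u i) r₁ r₂)
  simp only [sub_zero, smul_eq_mul, Real.exp_zero] at e
  rw [← e]
  simp only [Function.comp, gF]
  ring

lemma measurable_hI (d : ℕ) (lam : ℝ) (F : Measure ℝ) [IsProbabilityMeasure F] :
    Measurable (hI d lam F) := by
  have h : StronglyMeasurable (fun p : ℝ × ℝ => (p.1 + p.2) ^ d) :=
    Measurable.stronglyMeasurable (by fun_prop)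
  have h' := (h.integral_prod_right' (ν := F)).measurable
  unfold hI
  exact ((h'.const_mul _).neg).exp

lemma measurable_qI (d : ℕ) (lam : ℝ) (F : Measure ℝ) [IsProbabilityMeasure F] :
    Measurable (fun p : ℝ × ℝ × ℝ => qI d lam F p.1 p.2.1 p.2.2) := by
  have hh := measurable_hI d lam F
  have m1 : Measurable (fun p : ℝ × ℝ × ℝ => hI d lam F p.2.1 * hI d lam F p.2.2) :=
    (hh.comp (by fun_prop)).mul (hh.comp (by fun_prop))
  have m2 : StronglyMeasurable (fun p : (ℝ × ℝ × ℝ) × ℝ =>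
      interVol d 0 (p.1.2.1 + p.2) (p.1.1 • e1 d) (p.1.2.2 + p.2)) := by
    apply Measurable.stronglyMeasurable
    exact (measurable_interVol d).comp (g := fun q => interVol d q.1 q.2.1 q.2.2.1 q.2.2.2)
      (f := fun p : (ℝ × ℝ × ℝ) × ℝ =>
        ((0 : Euc d), p.1.2.1 + p.2, p.1.1 • e1 d, p.1.2.2 + p.2)) (by fun_prop)
  have m3 := (m2.integral_prod_right' (ν := F)).measurable
  unfold qI h2I
  refine Measurable.sub (Measurable.ite ?_ measurable_const (m1.mul (m3.const_mul lam).exp)) m1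
  exact measurableSet_le (by fun_prop) (by fun_prop)

end QPart

section Assembly

lemma interVol_meas {β : Type*} [MeasurableSpace β] {d : ℕ} {x y : β → Euc d} {r s : β → ℝ}
    (hx : Measurable x) (hr : Measurable r) (hy : Measurable y) (hs : Measurable s) :
    Measurable (fun b => interVol d (x b) (r b) (y b) (s b)) := by
  have hf : Measurable (fun b => (x b, r b, y b, s b)) := by fun_prop
  have h := (measurable_interVol d).comp hf
  simp only [Function.comp_def] at h
  exact h

lemma qI_meas {β : Type*} [MeasurableSpace β] {d : ℕ} {lam : ℝ} {F : Measure ℝ}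
    [IsProbabilityMeasure F] {u r s : β → ℝ}
    (hu : Measurable u) (hr : Measurable r) (hs : Measurable s) :
    Measurable (fun b => qI d lam F (u b) (r b) (s b)) :=
  (measurable_qI d lam F).comp (hu.prodMk (hr.prodMk hs))

lemma mul_exp_neg_le {b x : ℝ} (hb : 0 < b) : x * Real.exp (-(b * x)) ≤ 1 / b := by
  have h1 := Real.add_one_le_exp (b * x)
  have h2 : Real.exp (-(b * x)) * Real.exp (b * x) = 1 := by rw [← Real.exp_add]; simp
  rw [le_div_iff₀ hb]
  nlinarith [Real.exp_pos (-(b * x))]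

lemma nested_dct {ι : Type*} {L : Filter ι} [L.IsCountablyGenerated]
    {F : Measure ℝ} [IsProbabilityMeasure F] (hsupp : F (Iio 0) = 0)
    {φ : ι → ℝ → ℝ → ℝ} (hm : ∀ i, StronglyMeasurable (fun p : ℝ × ℝ => φ i p.1 p.2))
    {A : ℝ → ℝ → ℝ} {K : ℝ} (hK : ∀ᶠ i in L, ∀ r₁ ≥ 0, ∀ r₂ ≥ 0, |φ i r₁ r₂| ≤ K)
    (hlim : ∀ r₁ ≥ 0, ∀ r₂ ≥ 0, Tendsto (fun i => φ i r₁ r₂) L (nhds (A r₁ r₂))) :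
    Tendsto (fun i => ∫ r₁, ∫ r₂, φ i r₁ r₂ ∂F ∂F) L (nhds (∫ r₁, ∫ r₂, A r₁ r₂ ∂F ∂F)) := by
  have hF := ae_nonneg_F hsupp
  refine tendsto_integral_filter_of_dominated_convergence (fun _ => K) ?_ ?_
    (integrable_const K) ?_
  · exact Eventually.of_forall fun i =>
      ((hm i).integral_prod_right' (ν := F)).aestronglyMeasurable
  · filter_upwards [hK] with i hi
    filter_upwards [hF] with r₁ h1
    have := norm_integral_le_of_norm_le_const (μ := F) (f := fun r₂ => φ i r₁ r₂) (C := K) (by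
      filter_upwards [hF] with r₂ h2
      exact hi r₁ h1 r₂ h2)
    simpa using this
  · filter_upwards [hF] with r₁ h1
    refine tendsto_integral_filter_of_dominated_convergence (fun _ => K) ?_ ?_
      (integrable_const K) ?_
    · exact Eventually.of_forall fun i =>
        ((hm i).comp_measurable measurable_prodMk_left).aestronglyMeasurable
    · filter_upwards [hK] with i hi
      filter_upwards [hF] with r₂ h2
      exact hi r₁ h1 r₂ h2
    · filter_upwards [hF] with r₂ h2
      exact hlim r₁ h1 r₂ h2

lemma integrable_interVol {d : ℕ} (r₁ r₂ : ℝ) :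
    Integrable (fun x : Euc d => interVol d 0 r₁ x r₂) := by
  have hi : Integrable ((closedBall (0 : Euc d) (r₁ + r₂)).indicator fun _ => ballVol d r₁) :=
    (integrable_indicator_iff measurableSet_closedBall).2
      (integrableOn_const measure_closedBall_lt_top.ne)
  refine hi.mono' ?_ ?_
  · apply Measurable.aestronglyMeasurable
    exact interVol_meas measurable_const measurable_const measurable_id measurable_const
  · refine Eventually.of_forall fun x => ?_
    rw [Real.norm_of_nonneg (interVol_nonneg ..)]
    by_cases hx : x ∈ closedBall (0 : Euc d) (r₁ + r₂)
    · rw [indicator_of_mem hx]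
      exact interVol_le_left ..
    · rw [indicator_of_notMem hx, interVol_eq_zero]
      rw [mem_closedBall, not_le, dist_comm] at hx
      exact hx

lemma tendsto_dist_ratio {d : ℕ} (x : Euc d) :
    Tendsto (fun z : Euc d => ‖x - z‖ / ‖z‖) (comap norm atTop) (nhds 1) := by
  have hw : Tendsto (norm : Euc d → ℝ) (comap norm atTop) atTop := tendsto_comap
  have k : Tendsto (fun z : Euc d => ‖x‖ / ‖z‖) (comap norm atTop) (nhds 0) :=
    hw.const_div_atTop _
  rw [tendsto_iff_norm_sub_tendsto_zero]
  refine squeeze_zero' (Eventually.of_forall fun _ => norm_nonneg _) ?_ k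
  filter_upwards [hw.eventually_gt_atTop 0] with z hz
  rw [show ‖x - z‖ / ‖z‖ - 1 = (‖x - z‖ - ‖z‖) / ‖z‖ by field_simp, norm_div, norm_norm]
  gcongr
  have := abs_norm_sub_norm_le (x - z) (-z)
  rw [norm_neg] at this
  simpa using this


lemma hI_int_pos {d : ℕ} {lam : ℝ} (hlam : 0 < lam) {F : Measure ℝ} [IsProbabilityMeasure F]
    (hsupp : F (Iio 0) = 0) (hmom : Integrable (fun r : ℝ => r ^ d) F) :
    Integrable (hI d lam F) F ∧ 0 < ∫ r, hI d lam F r ∂F := by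
  have hInteg : Integrable (hI d lam F) F := by
    refine (integrable_const (1:ℝ)).mono' (measurable_hI d lam F).aestronglyMeasurable ?_
    filter_upwards [ae_nonneg_F hsupp] with r h
    rw [Real.norm_of_nonneg (hI_pos ..).le]
    exact hI_le_one hlam hsupp hmom h
  refine ⟨hInteg, ?_⟩
  rw [integral_pos_iff_support_of_nonneg (fun y => (hI_pos ..).le) hInteg]
  have : Function.support (hI d lam F) = univ := by
    ext y; simp [(hI_pos d lam F y).ne']
  rw [this]
  simp

lemma ballVol_hI_le {d : ℕ} {lam : ℝ} (hlam : 0 < lam) {F : Measure ℝ} [IsProbabilityMeasure F]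
    (hsupp : F (Iio 0) = 0) (hmom : Integrable (fun r : ℝ => r ^ d) F) {r : ℝ} (h : 0 ≤ r) :
    ballVol d r * hI d lam F r ≤ ballVol d 1 * (1 / (lam * ballVol d 1 / 2)) *
      Real.exp (-(lam * ballVol d 1 / 2 * r ^ d)) := by
  have hb := ballVol_one_pos d
  have h1 := hI_le hlam hsupp hmom h
  have h2 := mul_exp_neg_le (b := lam * ballVol d 1 / 2) (x := r ^ d) (by positivity)
  rw [ballVol_eq h]
  calc ballVol d 1 * r ^ d * hI d lam F r ≤
        ballVol d 1 * r ^ d * Real.exp (-(lam * ballVol d 1 * r ^ d)) := by gcongr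
    _ = ballVol d 1 * (r ^ d * Real.exp (-(lam * ballVol d 1 / 2 * r ^ d))) *
        Real.exp (-(lam * ballVol d 1 / 2 * r ^ d)) := by
      rw [show -(lam * ballVol d 1 * r ^ d) = -(lam * ballVol d 1 / 2 * r ^ d) +
        -(lam * ballVol d 1 / 2 * r ^ d) by ring, Real.exp_add]
      ring
    _ ≤ _ := by gcongr

lemma measurable_ballVol (d : ℕ) : Measurable (ballVol d) := by
  have : Monotone (ballVol d) := fun a b hab =>
    ENNReal.toReal_mono measure_closedBall_lt_top.ne (measure_mono (closedBall_subset_closedBall hab))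
  exact this.measurable

lemma ballVol_hI_pos {d : ℕ} {lam : ℝ} (hlam : 0 < lam) {F : Measure ℝ} [IsProbabilityMeasure F]
    (hsupp : F (Iio 0) = 0) (hmom : Integrable (fun r : ℝ => r ^ d) F)
    (hpos : ∀ x, 0 < tailF F x) :
    0 < ∫ r, ballVol d r * hI d lam F r ∂F := by
  have hb := ballVol_one_pos d
  have hInteg : Integrable (fun r => ballVol d r * hI d lam F r) F := by
    refine (integrable_const (ballVol d 1 * (1 / (lam * ballVol d 1 / 2)))).mono'
      ((measurable_ballVol d).mul (measurable_hI d lam F)).aestronglyMeasurable ?_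
    filter_upwards [ae_nonneg_F hsupp] with r h
    rw [Real.norm_of_nonneg (mul_nonneg (ballVol_nonneg ..) (hI_pos ..).le)]
    refine (ballVol_hI_le hlam hsupp hmom h).trans (mul_le_of_le_one_right (by positivity) ?_)
    rw [Real.exp_le_one_iff]
    have : 0 ≤ lam * ballVol d 1 / 2 * r ^ d := by positivity
    linarith
  rw [integral_pos_iff_support_of_nonneg
    (fun y => mul_nonneg (ballVol_nonneg ..) (hI_pos ..).le) hInteg]
  have h0 : 0 < F (Ioi 0) := (ENNReal.toReal_pos_iff.1 (hpos 0)).1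
  refine lt_of_lt_of_le h0 (measure_mono fun r hr => ?_)
  have hr' : (0:ℝ) < r := hr
  rw [Function.mem_support, ballVol_eq hr'.le]
  have := hI_pos d lam F r
  positivity

lemma xi_tendsto {d : ℕ} (hd : 0 < d) {lam : ℝ} (hlam : 0 < lam)
    {F : Measure ℝ} [IsProbabilityMeasure F]
    (hsupp : F (Iio 0) = 0) (hmom : Integrable (fun r : ℝ => r ^ d) F)
    {α : ℝ} (hα : (d : ℝ) < α) (hpos : ∀ x, 0 < tailF F x)
    (hr : ∀ a > 0, Tendsto (fun t => tailF F (a * t) / tailF F t) atTop (nhds (a ^ (-α)))) :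
    Tendsto (fun z : Euc d => (∫ r₁, ∫ r₂, qI d lam F ‖z‖ r₁ r₂ ∂F ∂F) / gF d F ‖z‖)
      (comap norm atTop) (nhds ((∫ r, hI d lam F r ∂F) ^ 2 * (lam * cconst d α))) := by
  have hw : Tendsto (norm : Euc d → ℝ) (comap norm atTop) atTop := tendsto_comap
  obtain ⟨C, hC, b, hb, w0, hw0, H⟩ := qI_bound hd hlam hsupp hmom hα hpos hr
  have key := nested_dct (L := comap (norm : Euc d → ℝ) atTop) hsupp
    (φ := fun z r₁ r₂ => qI d lam F ‖z‖ r₁ r₂ / gF d F ‖z‖)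
    (A := fun r₁ r₂ => hI d lam F r₁ * hI d lam F r₂ * (lam * cconst d α)) (K := C) ?_ ?_ ?_
  · simp_rw [integral_div, integral_mul_const, integral_const_mul, integral_mul_const] at key
    rwa [← pow_two] at key
  · intro z
    apply Measurable.stronglyMeasurable
    exact ((measurable_qI d lam F).comp (g := fun q => qI d lam F q.1 q.2.1 q.2.2)
      (f := fun p : ℝ × ℝ => (‖z‖, p.1, p.2)) (by fun_prop)).div_const _
  · filter_upwards [hw.eventually_ge_atTop w0] with z hz r₁ h1 r₂ h2
    have hg := gF_pos (d := d) hpos (show 0 < ‖z‖ by linarith)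
    rw [abs_div, abs_of_pos hg, div_le_iff₀ hg]
    refine (H _ hz ‖z‖ r₁ r₂ h1 h2 (by simpa using add_nonneg h1 h2)).trans ?_
    refine mul_le_of_le_one_right (by positivity) ?_
    rw [← Real.exp_add, Real.exp_le_one_iff]
    have : 0 ≤ b * r₁ ^ d := by have : (0:ℝ) ≤ r₁ := h1; positivity
    have : 0 ≤ b * r₂ ^ d := by have : (0:ℝ) ≤ r₂ := h2; positivity
    linarith
  · intro r₁ h1 r₂ h2
    refine qI_tendsto hd hα hpos hr hw ?_ h1 h2
    refine tendsto_const_nhds.congr' ?_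
    filter_upwards [hw.eventually_gt_atTop 0] with z hz
    rw [div_self hz.ne']

lemma k2_tendsto {d : ℕ} (hd : 0 < d) {lam : ℝ} (hlam : 0 < lam)
    {F : Measure ℝ} [IsProbabilityMeasure F]
    (hsupp : F (Iio 0) = 0) (hmom : Integrable (fun r : ℝ => r ^ d) F)
    {α : ℝ} (hα : (d : ℝ) < α) (hpos : ∀ x, 0 < tailF F x)
    (hr : ∀ a > 0, Tendsto (fun t => tailF F (a * t) / tailF F t) atTop (nhds (a ^ (-α)))) :
    Tendsto (fun z : Euc d => (∫ r₁, (∫ r₂, (∫ x : Euc d,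
        interVol d 0 r₁ x r₂ * qI d lam F ‖x - z‖ r₁ r₂) ∂F) ∂F) / gF d F ‖z‖)
      (comap norm atTop)
      (nhds ((∫ r, ballVol d r * hI d lam F r ∂F) ^ 2 * (lam * cconst d α))) := by
  have hw : Tendsto (norm : Euc d → ℝ) (comap norm atTop) atTop := tendsto_comap
  have hbv := ballVol_one_pos d
  obtain ⟨C, hC, b, hb, w0, hw0, H⟩ := qI_bound hd hlam hsupp hmom hα hpos hr
  have hmeas : ∀ z : Euc d, Measurable (fun p : (ℝ × ℝ) × Euc d =>
      interVol d 0 p.1.1 p.2 p.1.2 * qI d lam F ‖p.2 - z‖ p.1.1 p.1.2) := by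
    intro z
    refine Measurable.mul ?_ ?_
    · exact interVol_meas measurable_const measurable_fst.fst measurable_snd measurable_fst.snd
    · exact qI_meas (measurable_snd.sub_const z).norm measurable_fst.fst measurable_fst.snd
  have hdom : ∀ z : Euc d, w0 ≤ ‖z‖ → ∀ r₁ ≥ 0, ∀ r₂ ≥ 0, ∀ x : Euc d,
      ‖interVol d 0 r₁ x r₂ * qI d lam F ‖x - z‖ r₁ r₂ / gF d F ‖z‖‖ ≤
        interVol d 0 r₁ x r₂ * (C * (Real.exp (-(b * r₁ ^ d)) * Real.exp (-(b * r₂ ^ d)))) := by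
    intro z hz r₁ h1 r₂ h2 x
    have hg := gF_pos (d := d) hpos (show 0 < ‖z‖ by linarith)
    rw [mul_div_assoc, norm_mul, Real.norm_of_nonneg (interVol_nonneg ..)]
    by_cases hx : r₁ + r₂ < dist 0 x
    · rw [interVol_eq_zero hx]; simp
    · rw [not_lt, dist_zero_left] at hx
      refine mul_le_mul_of_nonneg_left ?_ (interVol_nonneg ..)
      rw [norm_div, Real.norm_eq_abs, Real.norm_of_nonneg hg.le, div_le_iff₀ hg]
      have hxz : |‖x - z‖ - ‖z‖| ≤ r₁ + r₂ := by
        have := abs_norm_sub_norm_le (x - z) (-z)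
        rw [norm_neg] at this
        refine this.trans ?_
        simpa using hx
      refine (H _ hz _ r₁ r₂ h1 h2 hxz).trans (le_of_eq ?_)
      ring
  have key := nested_dct (L := comap (norm : Euc d → ℝ) atTop) hsupp
    (φ := fun z r₁ r₂ => ∫ x : Euc d,
      interVol d 0 r₁ x r₂ * qI d lam F ‖x - z‖ r₁ r₂ / gF d F ‖z‖)
    (A := fun r₁ r₂ => (ballVol d r₁ * hI d lam F r₁) * (ballVol d r₂ * hI d lam F r₂) *
      (lam * cconst d α)) (K := C * ((ballVol d 1 * (1 / b)) * (ballVol d 1 * (1 / b)))) ?_ ?_ ?_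
  · simp_rw [integral_div, integral_mul_const, integral_const_mul, integral_mul_const] at key
    rwa [← pow_two] at key
  · intro z
    exact (((hmeas z).div_const _).stronglyMeasurable).integral_prod_right'
  · filter_upwards [hw.eventually_ge_atTop w0] with z hz r₁ h1 r₂ h2
    have hr1 : (0:ℝ) ≤ r₁ := h1
    have hr2 : (0:ℝ) ≤ r₂ := h2
    have := norm_integral_le_of_norm_le ((integrable_interVol r₁ r₂).mul_const
      (C * (Real.exp (-(b * r₁ ^ d)) * Real.exp (-(b * r₂ ^ d)))))
      (Eventually.of_forall (hdom z hz r₁ h1 r₂ h2))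
    rw [integral_mul_const, integral_interVol, ballVol_eq hr1, ballVol_eq hr2] at this
    refine this.trans ?_
    have m1 := mul_exp_neg_le (x := r₁ ^ d) hb
    have m2 := mul_exp_neg_le (x := r₂ ^ d) hb
    calc _ = C * ((ballVol d 1 * (r₁ ^ d * Real.exp (-(b * r₁ ^ d)))) *
          (ballVol d 1 * (r₂ ^ d * Real.exp (-(b * r₂ ^ d))))) := by ring
      _ ≤ _ := by gcongr
  · intro r₁ h1 r₂ h2
    have hA : (ballVol d r₁ * hI d lam F r₁) * (ballVol d r₂ * hI d lam F r₂) *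
        (lam * cconst d α) = ∫ x : Euc d, interVol d 0 r₁ x r₂ *
          (hI d lam F r₁ * hI d lam F r₂ * (lam * cconst d α)) := by
      rw [integral_mul_const, integral_interVol]
      ring
    rw [hA]
    refine tendsto_integral_filter_of_dominated_convergence
      (fun x => interVol d 0 r₁ x r₂ *
        (C * (Real.exp (-(b * r₁ ^ d)) * Real.exp (-(b * r₂ ^ d))))) ?_ ?_ ?_ ?_
    · refine Eventually.of_forall fun z => Measurable.aestronglyMeasurable ?_
      exact (((hmeas z).comp (measurable_prodMk_left (x := (r₁, r₂)))).div_const _)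
    · filter_upwards [hw.eventually_ge_atTop w0] with z hz
      exact Eventually.of_forall (hdom z hz r₁ h1 r₂ h2)
    · exact (integrable_interVol r₁ r₂).mul_const _
    · refine Eventually.of_forall fun x => ?_
      simp_rw [mul_div_assoc]
      exact (qI_tendsto hd hα hpos hr hw (tendsto_dist_ratio x) h1 h2).const_mul _

lemma k1_tendsto {d : ℕ} (hd : 0 < d) {lam : ℝ} (hlam : 0 < lam)
    {F : Measure ℝ} [IsProbabilityMeasure F]
    (hsupp : F (Iio 0) = 0) (hmom : Integrable (fun r : ℝ => r ^ d) F)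
    {α : ℝ} (hα : (d : ℝ) < α) (hpos : ∀ x, 0 < tailF F x)
    (hr : ∀ a > 0, Tendsto (fun t => tailF F (a * t) / tailF F t) atTop (nhds (a ^ (-α)))) :
    Tendsto (fun z : Euc d => (∫ r, interVol d 0 r z r * hI d lam F r ∂F) / gF d F ‖z‖)
      (comap norm atTop) (nhds 0) := by
  have hw : Tendsto (norm : Euc d → ℝ) (comap norm atTop) atTop := tendsto_comap
  have hbv := ballVol_one_pos d
  set a := lam * ballVol d 1 / 2 with ha
  have ha0 : 0 < a := by positivity
  set K := ballVol d 1 * (1 / a) with hK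
  have hlim := ((exp_div_gF_tendsto hd hα hpos hr
    (b := a * (1/2) ^ d) (by positivity)).comp hw).const_mul K
  rw [mul_zero] at hlim
  refine squeeze_zero' ?_ ?_ hlim
  · filter_upwards [hw.eventually_gt_atTop 0] with z hz
    exact div_nonneg (integral_nonneg fun r => mul_nonneg (interVol_nonneg ..) (hI_pos ..).le)
      (gF_pos hpos hz).le
  · filter_upwards [hw.eventually_gt_atTop 0] with z hz
    have hg := gF_pos (d := d) hpos hz
    simp only [Function.comp]
    rw [← mul_div_assoc]
    gcongr
    have := norm_integral_le_of_norm_le_const (μ := F)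
      (f := fun r => interVol d 0 r z r * hI d lam F r)
      (C := K * Real.exp (-(a * (1/2) ^ d * ‖z‖ ^ d))) (by
        filter_upwards [ae_nonneg_F hsupp] with r h
        rw [Real.norm_of_nonneg (mul_nonneg (interVol_nonneg ..) (hI_pos ..).le)]
        by_cases hx : r + r < dist 0 z
        · rw [interVol_eq_zero hx, zero_mul]
          positivity
        · rw [not_lt, dist_zero_left] at hx
          refine (mul_le_mul_of_nonneg_right (interVol_le_left ..) (hI_pos ..).le).trans ?_
          refine (ballVol_hI_le hlam hsupp hmom h).trans ?_
          rw [← ha, ← hK]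
          have m3 : (1/2) ^ d * ‖z‖ ^ d ≤ r ^ d := by
            rw [← mul_pow]
            exact pow_le_pow_left₀ (by positivity) (by linarith) d
          have m4 : a * (1/2) ^ d * ‖z‖ ^ d ≤ a * r ^ d := by
            rw [mul_assoc]; gcongr
          have hK0 : 0 ≤ K := by positivity
          exact mul_le_mul_of_nonneg_left (Real.exp_le_exp.2 (by linarith)) hK0)
    simp only [probReal_univ, mul_one] at this
    exact (le_abs_self _).trans this

end Assembly

/-- Matérn type I (isolated grains retained): exponential radius tail bound,
power-law decay of the covariance of the grain cover and of the two-point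
correlation of the grain centers. -/
theorem stmt13 (d : ℕ) (hd : 0 < d) (lam : ℝ) (hlam : 0 < lam)
    (F : Measure ℝ) [IsProbabilityMeasure F] (hsupp : F (Iio 0) = 0)
    (hmom : Integrable (fun r : ℝ => r ^ d) F)
    (α : ℝ) (hα : (d : ℝ) < α)
    (ℓ : ℝ → ℝ) (hℓ : SlowlyVarying ℓ)
    (htail : ∀ x > 0, tailF F x = ℓ x * x ^ (-α)) :
    (∀ r ≥ (0:ℝ), tailth lam F (hI d lam F) r ≤
        (lam / lamth lam F (hI d lam F)) * Real.exp (-(lam * ballVol d 1 * r ^ d))) ∧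
    Tendsto
      (fun z : Euc d =>
        kth d lam F (hI d lam F) (qI d lam F) z /
          (lam * cconst d α * pth d lam F (hI d lam F) ^ 2 * ℓ ‖z‖ * ‖z‖ ^ (-(α - d))))
      (comap norm atTop) (nhds 1) ∧
    Tendsto
      (fun z : Euc d =>
        xith d lam F (hI d lam F) (qI d lam F) z /
          (lam * cconst d α * ℓ ‖z‖ * ‖z‖ ^ (-(α - d))))
      (comap norm atTop) (nhds 1) := by
  have hpos := tailF_pos hℓ htail
  have hr := tailF_ratio hℓ htail
  have hbv := ballVol_one_pos d
  obtain ⟨hInteg, hH⟩ := hI_int_pos hlam hsupp hmom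
  have hlamth : 0 < lamth lam F (hI d lam F) := mul_pos hlam hH
  have hB := ballVol_hI_pos hlam hsupp hmom hpos
  have hc : 0 < cconst d α := by
    rw [cconst_eq hd hα]
    exact mF_rpow_integral_pos hd hα
  have hw : Tendsto (norm : Euc d → ℝ) (comap norm atTop) atTop := tendsto_comap
  have hgF : ∀ w > 0, gF d F w = ℓ w * w ^ (-(α - d)) := by
    intro w hw
    unfold gF
    rw [htail w hw, show -(α - (d:ℝ)) = d + -α by ring, Real.rpow_add hw, Real.rpow_natCast]
    ring
  refine ⟨?_, ?_, ?_⟩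
  · intro r hr0
    unfold tailth
    refine mul_le_mul_of_nonneg_left ?_ (div_pos hlam hlamth).le
    calc ∫ s in Ioi r, hI d lam F s ∂F ≤
          ∫ s in Ioi r, Real.exp (-(lam * ballVol d 1 * r ^ d)) ∂F := by
          refine setIntegral_mono_on hInteg.integrableOn (integrable_const _) measurableSet_Ioi ?_
          intro s hs
          have hs' : r < s := hs
          refine (hI_le hlam hsupp hmom (by linarith)).trans ?_
          gcongr
      _ ≤ _ := by
          rw [setIntegral_const, smul_eq_mul]
          exact mul_le_of_le_one_left (Real.exp_pos _).le measureReal_le_one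
  · have h1 := (k1_tendsto hd hlam hsupp hmom hα hpos hr).const_mul lam
    have h2 := (k2_tendsto hd hlam hsupp hmom hα hpos hr).const_mul (lam ^ 2)
    have hp : 0 < pth d lam F (hI d lam F) := mul_pos hlam hB
    have h3 := (h1.add h2).div_const (lam * cconst d α * pth d lam F (hI d lam F) ^ 2)
    have e : (lam * 0 + lam ^ 2 * ((∫ r, ballVol d r * hI d lam F r ∂F) ^ 2 *
        (lam * cconst d α))) / (lam * cconst d α * pth d lam F (hI d lam F) ^ 2) = 1 := by
      rw [div_eq_one_iff_eq (by positivity)]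
      unfold pth
      ring
    rw [e] at h3
    refine h3.congr' ?_
    filter_upwards [hw.eventually_gt_atTop 0] with z hz
    have hg := gF_pos (d := d) hpos hz
    rw [mul_assoc _ (ℓ ‖z‖), ← hgF _ hz]
    unfold kth
    field_simp
  · have h2 := (xi_tendsto hd hlam hsupp hmom hα hpos hr).const_mul
      ((lam / lamth lam F (hI d lam F)) ^ 2)
    have h3 := h2.div_const (lam * cconst d α)
    have e : (lam / lamth lam F (hI d lam F)) ^ 2 * ((∫ r, hI d lam F r ∂F) ^ 2 *
        (lam * cconst d α)) / (lam * cconst d α) = 1 := by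
      unfold lamth
      field_simp
    rw [e] at h3
    refine h3.congr' ?_
    filter_upwards [hw.eventually_gt_atTop 0] with z hz
    have hg := gF_pos (d := d) hpos hz
    rw [mul_assoc _ (ℓ ‖z‖), ← hgF _ hz]
    unfold xith
    field_simp
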